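/- If Λ = (λ_1,…,λ_n), λ_i ∈ ℂ, is weakly hyperbolic, then the moment-angle manifold Z^ℂ(Λ) is cut out regularly: for every z ∈ Z^ℂ(Λ), the ℝ-linear map ℂ^n → ℂ × ℝ given by v ↦ (∑_{i=1}^n 2 Re(conj(z_i) v_i) λ_i, ∑_{i=1}^n 2 Re(conj(z_i) v_i)) is surjective (here ℂ^n is regarded as a real vector space). -/

import Mathlib

open scoped BigOperators

/-- The moment-angle manifold `Z^ℂ(Λ)` of a configuration of complex numbers. -/
def ZC {n : ℕ} (Λ : Fin n → ℂ) : Set (Fin n → ℂ) :=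
  {z | (∑ i, Λ i * (Complex.normSq (z i) : ℂ)) = 0 ∧ (∑ i, Complex.normSq (z i)) = 1}

/-- `Λ` is weakly hyperbolic (`k = 2`): for every subset `J` with at most `2` elements,
`0` is not in the convex hull of the `λ_i`, `i ∈ J`. -/
def WeaklyHyperbolicC {n : ℕ} (Λ : Fin n → ℂ) : Prop :=
  ∀ J : Finset (Fin n), J.card ≤ 2 → (0 : ℂ) ∉ convexHull ℝ (Λ '' ↑J)

/-- If a nonnegative combination with nonzero weights of real numbers vanishes, then one of the
numbers of positive weight is nonpositive. -/
theorem exists_pos_weight_nonpos {ι : Type*} [Fintype ι] {w t : ι → ℝ} (hw : ∀ i, 0 ≤ w i)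
    (hw' : ∑ i, w i ≠ 0) (h : ∑ i, w i * t i = 0) : ∃ i, 0 < w i ∧ t i ≤ 0 := by
  by_contra! hc
  have hnonneg : ∀ i, 0 ≤ w i * t i := fun i =>
    (hw i).eq_or_lt.elim (fun h0 => by simp [← h0]) fun h0 => (mul_pos h0 (hc i h0)).le
  rw [Finset.sum_eq_zero_iff_of_nonneg fun i _ => hnonneg i] at h
  refine hw' (Finset.sum_eq_zero fun i hi => ?_)
  by_contra h0
  have hpos := (hw i).lt_of_ne' h0
  exact (mul_pos hpos (hc i hpos)).ne' (h i hi)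

/-- Two points `x`, `y` on the line `a * re + b * im = 0`, lying weakly on opposite sides of the
origin, have the origin in the segment joining them. -/
theorem zero_mem_segment_of_line {a b : ℝ} (hab : a ≠ 0 ∨ b ≠ 0) {x y : ℂ}
    (hx : a * x.re + b * x.im = 0) (hy : a * y.re + b * y.im = 0)
    (hx' : a * x.im - b * x.re ≤ 0) (hy' : 0 ≤ a * y.im - b * y.re) :
    (0 : ℂ) ∈ segment ℝ x y := by
  have hs : 0 < a ^ 2 + b ^ 2 := by
    rcases hab with h | h <;> positivity
  have key : ∀ u : ℂ, a * u.re + b * u.im = 0 → a * u.im - b * u.re = 0 → u = 0 := by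
    intro u h1 h2
    apply Complex.ext
    · exact (mul_eq_zero.1 (show (a ^ 2 + b ^ 2) * u.re = 0 by
        linear_combination a * h1 - b * h2)).resolve_left hs.ne'
    · exact (mul_eq_zero.1 (show (a ^ 2 + b ^ 2) * u.im = 0 by
        linear_combination b * h1 + a * h2)).resolve_left hs.ne'
  rcases hx'.eq_or_lt with h0 | h0
  · rw [key x hx h0]
    exact left_mem_segment ℝ 0 y
  set p := a * x.im - b * x.re with hp
  set q := a * y.im - b * y.re with hq
  have hd : 0 < q - p := by linarith
  refine ⟨q / (q - p), -p / (q - p), div_nonneg hy' hd.le, div_nonneg (by linarith) hd.le, ?_, ?_⟩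
  · field_simp
    ring
  · have hcomb : q • x + (-p) • y = 0 := by
      apply key
      · simp only [Complex.add_re, Complex.add_im, Complex.real_smul, Complex.re_ofReal_mul,
          Complex.im_ofReal_mul]
        linear_combination q * hx - p * hy
      · simp only [Complex.add_re, Complex.add_im, Complex.real_smul, Complex.re_ofReal_mul,
          Complex.im_ofReal_mul]
        linear_combination p * hq - q * hp
    rw [div_eq_inv_mul, div_eq_inv_mul, mul_smul, mul_smul, ← smul_add, hcomb, smul_zero]

/-- The real derivative at `z` of `z ↦ (∑ λᵢ |zᵢ|², ∑ |zᵢ|²)`. -/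
noncomputable def momentDeriv {n : ℕ} (Λ z : Fin n → ℂ) : (Fin n → ℂ) →ₗ[ℝ] ℂ × ℝ where
  toFun v := (∑ i, (2 * ((starRingEnd ℂ) (z i) * v i).re) • Λ i,
    ∑ i, 2 * ((starRingEnd ℂ) (z i) * v i).re)
  map_add' u v := by
    simp only [Pi.add_apply, mul_add, Complex.add_re, add_smul, Finset.sum_add_distrib,
      Prod.mk_add_mk]
  map_smul' c v := by
    have h : ∀ i, 2 * ((starRingEnd ℂ) (z i) * (c • v) i).re =
        c * (2 * ((starRingEnd ℂ) (z i) * v i).re) := fun i => by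
      rw [Pi.smul_apply, mul_smul_comm, Complex.smul_re, smul_eq_mul]
      ring
    simp only [h, mul_smul, ← Finset.smul_sum, ← Finset.mul_sum, RingHom.id_apply, Prod.smul_mk,
      smul_eq_mul]

theorem momentDeriv_single {n : ℕ} (Λ z : Fin n → ℂ) (i : Fin n) :
    momentDeriv Λ z (Pi.single i (z i)) = (2 * Complex.normSq (z i)) • (Λ i, (1 : ℝ)) := by
  have h : ∀ j, 2 * ((starRingEnd ℂ) (z j) * (Pi.single i (z i) : Fin n → ℂ) j).re =
      if j = i then 2 * Complex.normSq (z i) else 0 := by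
    intro j
    rcases eq_or_ne j i with rfl | hj
    · simp [Complex.normSq_apply]
    · simp [hj]
  simp only [momentDeriv, LinearMap.coe_mk, AddHom.coe_mk, h]
  simp

theorem linearMap_complex_prod_real_apply (f : ℂ × ℝ →ₗ[ℝ] ℝ) (p : ℂ × ℝ) :
    f p = f (1, 0) * p.1.re + f (Complex.I, 0) * p.1.im + f (0, 1) * p.2 := by
  have hp : p = p.1.re • ((1 : ℂ), (0 : ℝ)) + p.1.im • (Complex.I, (0 : ℝ))
      + p.2 • ((0 : ℂ), (1 : ℝ)) := by
    ext <;> simp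
  conv_lhs => rw [hp]
  simp only [map_add, map_smul, smul_eq_mul]
  ring

/-- If `Λ` is weakly hyperbolic then the moment-angle manifold `Z^ℂ(Λ)` is cut out regularly:
at every `z ∈ Z^ℂ(Λ)`, the real derivative
`v ↦ (∑ 2 Re(conj(zᵢ) vᵢ) λᵢ, ∑ 2 Re(conj(zᵢ) vᵢ))` is surjective onto `ℂ × ℝ`. -/
theorem regular_value_momentAngle {n : ℕ} (hn : 1 ≤ n)
    (Λ : Fin n → ℂ) (hΛ : WeaklyHyperbolicC Λ)
    (z : Fin n → ℂ) (hz : z ∈ ZC Λ) :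
    Function.Surjective (fun v : Fin n → ℂ =>
      ((∑ i, (2 * ((starRingEnd ℂ) (z i) * v i).re) • Λ i,
        ∑ i, 2 * ((starRingEnd ℂ) (z i) * v i).re) : ℂ × ℝ)) := by
  change Function.Surjective (momentDeriv Λ z)
  rw [← LinearMap.range_eq_top]
  by_contra hne
  obtain ⟨f, hf0, hf⟩ := Submodule.exists_le_ker_of_lt_top _ (lt_top_iff_ne_top.2 hne)
  have hform := linearMap_complex_prod_real_apply f
  set a := f (1, 0)
  set b := f (Complex.I, 0)
  set c := f (0, 1)
  obtain ⟨hz0, hz1⟩ := hz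
  set w : Fin n → ℝ := fun i => Complex.normSq (z i) with hw
  have hw1 : ∑ i, w i = 1 := hz1
  have hre : ∑ i, w i * (Λ i).re = 0 := by
    simpa [mul_comm, hw] using congrArg Complex.re hz0
  have him : ∑ i, w i * (Λ i).im = 0 := by
    simpa [mul_comm, hw] using congrArg Complex.im hz0
  have hker : ∀ i, w i * (a * (Λ i).re + b * (Λ i).im + c) = 0 := by
    intro i
    have h : f (momentDeriv Λ z (Pi.single i (z i))) = 0 := hf (LinearMap.mem_range_self _ _)
    rw [momentDeriv_single, map_smul, hform, smul_eq_mul] at h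
    linear_combination h / 2
  have hcomb : ∀ α β : ℝ, ∑ i, w i * (α * (Λ i).re + β * (Λ i).im) = 0 := by
    intro α β
    simp only [mul_add, Finset.sum_add_distrib, mul_left_comm (w _), ← Finset.mul_sum, hre, him,
      mul_zero, add_zero]
  have hc : c = 0 := by
    have h : ∑ i, w i * (a * (Λ i).re + b * (Λ i).im + c) = 0 :=
      Finset.sum_eq_zero fun i _ => hker i
    simpa only [mul_add _ _ c, Finset.sum_add_distrib, hcomb, ← Finset.sum_mul, hw1, zero_add,
      one_mul] using h
  have hab : a ≠ 0 ∨ b ≠ 0 := by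
    by_contra! h
    exact hf0 (LinearMap.ext fun p => by simp [hform p, h.1, h.2, hc])
  have hline : ∀ i, 0 < w i → a * (Λ i).re + b * (Λ i).im = 0 := fun i hi => by
    simpa [hc, hi.ne'] using hker i
  have hw0 : ∀ i, 0 ≤ w i := fun i => Complex.normSq_nonneg _
  obtain ⟨i, hi, hi'⟩ := exists_pos_weight_nonpos hw0 (hw1.trans_ne one_ne_zero) (hcomb (-b) a)
  obtain ⟨j, hj, hj'⟩ := exists_pos_weight_nonpos hw0 (hw1.trans_ne one_ne_zero) (hcomb b (-a))
  refine hΛ {i, j} Finset.card_le_two ?_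
  rw [Finset.coe_pair, Set.image_pair, convexHull_pair]
  exact zero_mem_segment_of_line hab (hline i hi) (hline j hj) (by linarith) (by linarith)
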